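/- arXiv:2101.04058 — 3 statements merged into one kernel-verified Lean document; each statement's English description precedes it below -/
import Mathlib

section
/- For all integers n ≥ 0 and ℓ ≥ 1, PD_{3^ℓ}(n) ≡ e_{n,ℓ} (mod 3), where e_{n,ℓ} denotes the number of tuples (k_0, k_1, k_1', k_2, k_2', …, k_{ℓ-1}, k_{ℓ-1}', k_ℓ) of integers such that n = k_0² + Σ_{m=1}^{ℓ-1} 3^m (k_m² + k_m'²) + 3^ℓ k_ℓ² and every odd coordinate of the tuple is positive (even coordinates may be any integer of either sign). -/
/-- `PD k n` is the number of partitions of `n` with designated summands whose parts are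
not divisible by `k`: the sum over partitions of `n` with no part divisible by `k` of the
product of the multiplicities of the distinct part sizes. -/
def PD (k n : ℕ) : ℕ :=
  ∑ p : n.Partition,
    if ∀ s ∈ p.parts, ¬ k ∣ s then ∏ s ∈ p.parts.toFinset, p.parts.count s else 0

open Finset PowerSeries Filter
open scoped PowerSeries.WithPiTopology

/-- Finite form of Gauss's identity for `∑ (-1) ^ m q ^ m ^ 2`. -/
theorem finite_gauss_identity {R : Type*} [CommRing R] (q : R) (n : ℕ) :
    (1 + ∑ m ∈ range n, 2 * (-1) ^ (m + 1) * q ^ ((m + 1) ^ 2)) *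
        ∏ i ∈ range n, (1 + q ^ (i + 1)) =
      ∑ j ∈ range (n + 1), (-1) ^ j * (∏ i ∈ range j, (1 + q ^ i)) *
        (∏ i ∈ Ico j n, (1 - q ^ (i + 1))) * q ^ (j * (n + 1)) := by
  induction n with
  | zero => simp
  | succ n ih =>
    have htel : ∀ J ≤ n, ∑ j ∈ range (J + 1), ((-1) ^ j * (∏ i ∈ range j, (1 + q ^ i)) *
          (∏ i ∈ Ico j (n + 1), (1 - q ^ (i + 1))) * q ^ (j * (n + 2)) -
        (1 + q ^ (n + 1)) * ((-1) ^ j * (∏ i ∈ range j, (1 + q ^ i)) *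
          (∏ i ∈ Ico j n, (1 - q ^ (i + 1))) * q ^ (j * (n + 1)))) =
        -((-1) ^ J * (∏ i ∈ range (J + 1), (1 + q ^ i)) *
          (∏ i ∈ Ico J n, (1 - q ^ (i + 1))) * q ^ ((J + 1) * (n + 1))) := by
      intro J
      induction J with
      | zero =>
        intro _
        rw [sum_range_one, prod_Ico_succ_top (by omega)]
        simp
        ring
      | succ J ihJ =>
        intro hJ
        rw [sum_range_succ, ihJ (by omega), prod_Ico_succ_top hJ,
          prod_eq_prod_Ico_succ_bot (show J < n by omega), prod_range_succ _ (J + 1)]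
        ring
    have hn := htel n le_rfl
    rw [sum_sub_distrib, ← mul_sum, ← ih, sub_eq_iff_eq_add] at hn
    have h1 : ∏ i ∈ range (n + 1), (1 + q ^ i) = 2 * ∏ i ∈ range n, (1 + q ^ (i + 1)) := by
      rw [prod_range_succ']
      ring
    rw [sum_range_succ _ (n + 1), hn, sum_range_succ _ n, prod_range_succ _ n, h1]
    simp only [Ico_self, prod_empty]
    ring

theorem exists_finite_gauss_identity_remainder {R : Type*} [CommRing R] (q : R) (n : ℕ) :
    ∃ r, (1 + ∑ m ∈ range n, 2 * (-1) ^ (m + 1) * q ^ ((m + 1) ^ 2)) *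
        ∏ i ∈ range n, (1 + q ^ (i + 1)) - ∏ i ∈ range n, (1 - q ^ (i + 1)) =
      q ^ (n + 1) * r := by
  rw [finite_gauss_identity, sum_range_succ']
  simp only [pow_zero, range_zero, prod_empty, Nat.Ico_zero_eq_range, zero_mul, mul_one, one_mul,
    add_sub_cancel_right]
  refine dvd_sum fun j _ ↦ Dvd.dvd.mul_left (pow_dvd_pow q ?_) _
  nlinarith

section WeightSeries

variable {α β : Type*}

/-- The generating function modulo 3 of a set of objects counted by weight. -/
noncomputable def weightSeries (w : α → ℕ) : (ZMod 3)⟦X⟧ :=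
  PowerSeries.mk fun n ↦ (Nat.card {a // w a = n} : ZMod 3)

/-- Pairs of total weight `n`, sorted by the weights of their components. -/
def weightProdEquiv (w : α → ℕ) (v : β → ℕ) (n : ℕ) :
    {p : α × β // w p.1 + v p.2 = n} ≃
      Σ x : antidiagonal n, {a // w a = x.1.1} × {b // v b = x.1.2} where
  toFun p := ⟨⟨(w p.1.1, v p.1.2), mem_antidiagonal.2 p.2⟩, ⟨p.1.1, rfl⟩, ⟨p.1.2, rfl⟩⟩
  invFun s := ⟨(s.2.1.1, s.2.2.1), by
    rw [s.2.1.2, s.2.2.2]; exact mem_antidiagonal.1 s.1.2⟩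
  left_inv _ := rfl
  right_inv := by
    rintro ⟨⟨⟨_, _⟩, _⟩, ⟨_, ha⟩, ⟨_, hb⟩⟩
    cases ha
    cases hb
    rfl

theorem finite_weight_prod {w : α → ℕ} {v : β → ℕ} (hw : ∀ n, Finite {a // w a = n})
    (hv : ∀ n, Finite {b // v b = n}) (n : ℕ) :
    Finite {p : α × β // w p.1 + v p.2 = n} :=
  Finite.of_equiv _ (weightProdEquiv w v n).symm

theorem weightSeries_prod {w : α → ℕ} {v : β → ℕ} (hw : ∀ n, Finite {a // w a = n})
    (hv : ∀ n, Finite {b // v b = n}) :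
    weightSeries (fun p : α × β ↦ w p.1 + v p.2) = weightSeries w * weightSeries v := by
  ext n
  simp only [weightSeries, coeff_mul, coeff_mk]
  rw [Nat.card_congr (weightProdEquiv w v n), Nat.card_sigma, Nat.cast_sum,
    ← Finset.sum_coe_sort (antidiagonal n)]
  simp [Nat.card_prod]

theorem weightSeries_congr {w : α → ℕ} {v : β → ℕ} (e : α ≃ β) (h : ∀ a, w a = v (e a)) :
    weightSeries w = weightSeries v := by
  ext n
  simp only [weightSeries, coeff_mk]
  rw [Nat.card_congr (e.subtypeEquiv (q := fun b ↦ v b = n) fun a ↦ by rw [h])]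

theorem weightSeries_pi {m : ℕ} {w : Fin m → α → ℕ} (hw : ∀ i n, Finite {a // w i a = n}) :
    (∀ n, Finite {f : Fin m → α // ∑ i, w i (f i) = n}) ∧
      weightSeries (fun f : Fin m → α ↦ ∑ i, w i (f i)) = ∏ i, weightSeries (w i) := by
  induction m with
  | zero =>
    refine ⟨fun n ↦ inferInstance, ?_⟩
    ext n
    rcases n with _ | n
    · simp [weightSeries]
    · simp [weightSeries, coeff_one]
  | succ m ih =>
    obtain ⟨hfin, hser⟩ := ih (w := fun i ↦ w i.succ) fun i ↦ hw i.succ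
    have he : ∀ f : Fin (m + 1) → α,
        ∑ i, w i (f i) = w 0 ((Fin.consEquiv fun _ ↦ α).symm f).1 +
          ∑ i : Fin m, w i.succ (((Fin.consEquiv fun _ ↦ α).symm f).2 i) := fun f ↦ by
      rw [Fin.sum_univ_succ]; rfl
    have hwt := weightSeries_congr (v := fun p : α × (Fin m → α) ↦
      w 0 p.1 + ∑ i, w i.succ (p.2 i)) (Fin.consEquiv fun _ ↦ α).symm he
    constructor
    · intro n
      have := finite_weight_prod (hw 0) hfin n
      exact Finite.of_equiv _ ((Fin.consEquiv fun _ ↦ α).symm.subtypeEquiv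
        (q := fun p : α × (Fin m → α) ↦ w 0 p.1 + ∑ i, w i.succ (p.2 i) = n)
        fun f ↦ by rw [he]).symm
    · rw [hwt, weightSeries_prod (hw 0) hfin, hser, Fin.prod_univ_succ]

end WeightSeries

/-- Integers that are positive if they are odd. -/
abbrev OddPos : Type := {x : ℤ // Odd x → 0 < x}

/-- The weight `k * x ^ 2` of an integer `x` that is positive if odd. -/
def oddPosWeight (k : ℕ) (x : OddPos) : ℕ := k * x.1.natAbs ^ 2

/-- The generating function modulo 3 of `k * x ^ 2` for `x` ranging over `OddPos`. -/
noncomputable def theta (k : ℕ) : (ZMod 3)⟦X⟧ :=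
  weightSeries (oddPosWeight k)

/-- The infinite product `∏ (1 + ε X ^ (k i))` over the positive integers `i`. -/
noncomputable def eulerProd (ε : ZMod 3) (k : ℕ) : (ZMod 3)⟦X⟧ :=
  ∏' i : ℕ, (1 + C ε * X ^ (k * (i + 1)))

/-- Elements of `OddPos` of given weight as a subset of an interval. -/
def oddPosEquiv {k n N : ℕ} (hk : 0 < k) (hN : n ≤ N) :
    {x : OddPos // oddPosWeight k x = n} ≃
      {x // x ∈ {x ∈ Icc (-(N : ℤ)) N | (Odd x → 0 < x) ∧ k * x.natAbs ^ 2 = n}} where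
  toFun x := ⟨x.1.1, by
    have h : x.1.1.natAbs ≤ n := by
      have hx : k * x.1.1.natAbs ^ 2 = n := x.2
      nlinarith [Nat.le_self_pow two_ne_zero x.1.1.natAbs]
    exact mem_filter.2 ⟨mem_Icc.2 ⟨by omega, by omega⟩, x.1.2, x.2⟩⟩
  invFun x := ⟨⟨x.1, (mem_filter.1 x.2).2.1⟩, (mem_filter.1 x.2).2.2⟩
  left_inv _ := rfl
  right_inv _ := rfl

theorem finite_oddPos_weight {k : ℕ} (hk : 0 < k) (n : ℕ) :
    Finite {x : OddPos // oddPosWeight k x = n} :=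
  Finite.of_equiv _ (oddPosEquiv hk le_rfl).symm

theorem sum_Icc_neg_succ {M : Type*} [AddCommMonoid M] (f : ℤ → M) (N : ℕ) :
    ∑ x ∈ Icc (-((N + 1 : ℕ) : ℤ)) (N + 1 : ℕ), f x =
      ∑ x ∈ Icc (-(N : ℤ)) N, f x + (f (N + 1) + f (-(N + 1))) := by
  have h : Icc (-((N + 1 : ℕ) : ℤ)) (N + 1 : ℕ) =
      insert ((N : ℤ) + 1) (insert (-((N : ℤ) + 1)) (Icc (-(N : ℤ)) N)) := by
    ext x
    simp only [mem_insert, mem_Icc]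
    omega
  rw [h, sum_insert (by simp; omega), sum_insert (by simp)]
  rw [← add_assoc, add_comm]

theorem coeff_theta_partial_sum (k n N : ℕ) :
    coeff n (1 + ∑ m ∈ range N, 2 * (-1) ^ (m + 1) * (X ^ k) ^ ((m + 1) ^ 2) : (ZMod 3)⟦X⟧) =
      ∑ x ∈ Icc (-(N : ℤ)) N, if (Odd x → 0 < x) ∧ k * x.natAbs ^ 2 = n then 1 else 0 := by
  induction N with
  | zero =>
    rw [Nat.cast_zero, neg_zero, Icc_self, sum_singleton]
    simp [coeff_one, eq_comm (a := n)]
  | succ N ih =>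
    rw [sum_range_succ, ← add_assoc, map_add, ih, sum_Icc_neg_succ]
    congr 1
    have h1 : ((N : ℤ) + 1).natAbs = N + 1 := by omega
    have h2 : (-((N : ℤ) + 1)).natAbs = N + 1 := by omega
    have h3 : (0 : ℤ) < N + 1 := by omega
    have h4 : ¬ (0 : ℤ) < -(N + 1) := by omega
    have h5 : (2 : (ZMod 3)⟦X⟧) * (-1) ^ (N + 1) = C (2 * (-1) ^ (N + 1)) := by
      rw [map_mul, map_pow, map_neg, map_one, map_ofNat]
    rw [h5, coeff_C_mul, ← pow_mul, coeff_X_pow, h1, h2]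
    simp only [h3, h4, eq_comm (a := n)]
    by_cases hn : k * (N + 1) ^ 2 = n
    · rcases Nat.even_or_odd (N + 1) with he | ho
      · have : ¬ Odd (-((N : ℤ) + 1)) := by
          rw [odd_neg, Int.not_odd_iff_even]; exact_mod_cast he
        simp only [hn, this, he.neg_one_pow, implies_true, false_imp_iff, and_true, if_true]
        decide
      · have : Odd (-((N : ℤ) + 1)) := by
          rw [odd_neg]; exact_mod_cast ho
        simp only [hn, this, ho.neg_one_pow, implies_true, true_imp_iff, and_true, if_true, if_false]
        decide
    · simp [hn]

theorem tendsto_theta {k : ℕ} (hk : 0 < k) :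
    Tendsto (fun N ↦ (1 + ∑ m ∈ range N, 2 * (-1) ^ (m + 1) * (X ^ k) ^ ((m + 1) ^ 2) :
      (ZMod 3)⟦X⟧)) atTop (nhds (theta k)) := by
  rw [WithPiTopology.tendsto_iff_coeff_tendsto]
  refine fun d ↦ tendsto_atTop_of_eventually_const (i₀ := d) fun N hN ↦ ?_
  rw [coeff_theta_partial_sum, theta, weightSeries, coeff_mk,
    Nat.card_congr (oddPosEquiv hk hN), Nat.card_eq_fintype_card, Fintype.card_coe, sum_boole]

theorem multipliable_eulerProd (ε : ZMod 3) {k : ℕ} (hk : 0 < k) :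
    Multipliable fun i : ℕ ↦ (1 + C ε * X ^ (k * (i + 1)) : (ZMod 3)⟦X⟧) := by
  apply WithPiTopology.multipliable_one_add_of_tendsto_order_atTop_nhds_top
  refine ENat.tendsto_nhds_top_iff_natCast_lt.mpr fun n ↦ eventually_atTop.mpr ⟨n, fun m hm ↦ ?_⟩
  have h : ((k * (m + 1) : ℕ) : ℕ∞) ≤ (C ε * X ^ (k * (m + 1)) : (ZMod 3)⟦X⟧).order := by
    refine le_trans ?_ (le_order_mul _ _)
    rw [order_X_pow]
    exact le_add_self
  refine lt_of_lt_of_le ?_ h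
  norm_cast
  nlinarith

theorem hasProd_eulerProd (ε : ZMod 3) {k : ℕ} (hk : 0 < k) :
    HasProd (fun i : ℕ ↦ (1 + C ε * X ^ (k * (i + 1)) : (ZMod 3)⟦X⟧)) (eulerProd ε k) :=
  (multipliable_eulerProd ε hk).hasProd

theorem eulerProd_ne_zero (ε : ZMod 3) {k : ℕ} (hk : 0 < k) : eulerProd ε k ≠ 0 := by
  intro h
  have h0 := congrArg constantCoeff h
  rw [eulerProd, (multipliable_eulerProd ε hk).map_tprod _
    (WithPiTopology.continuous_constantCoeff _)] at h0
  simp [hk.ne'] at h0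

theorem charP_three : CharP (ZMod 3)⟦X⟧ 3 :=
  charP_of_injective_ringHom (C_injective (R := ZMod 3)) 3

theorem eulerProd_pow_three (ε : ZMod 3) {k : ℕ} (hk : 0 < k) :
    eulerProd ε k ^ 3 = eulerProd ε (3 * k) := by
  have := charP_three
  rw [eulerProd, ← (multipliable_eulerProd ε hk).tprod_pow]
  refine tprod_congr fun i ↦ ?_
  rw [add_pow_char, one_pow, mul_pow, ← map_pow, ZMod.pow_card, ← pow_mul]
  congr 3
  ring

theorem theta_mul_eulerProd {k : ℕ} (hk : 0 < k) :
    theta k * eulerProd 1 k = eulerProd (-1) k := by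
  rw [← sub_eq_zero]
  have h1 := (hasProd_eulerProd 1 hk).tendsto_prod_nat
  have h2 := (hasProd_eulerProd (-1) hk).tendsto_prod_nat
  refine tendsto_nhds_unique (((tendsto_theta hk).mul h1).sub h2) ?_
  rw [WithPiTopology.tendsto_iff_coeff_tendsto]
  refine fun d ↦ tendsto_atTop_of_eventually_const (i₀ := d) fun N hN ↦ ?_
  obtain ⟨r, hr⟩ := exists_finite_gauss_identity_remainder (X ^ k : (ZMod 3)⟦X⟧) N
  simp only [map_one, map_neg, one_mul, neg_mul, ← sub_eq_add_neg, pow_mul]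
  simp only [← pow_mul] at hr ⊢
  rw [hr, coeff_X_pow_mul', if_neg (by nlinarith), map_zero]

theorem theta_ne_zero {k : ℕ} (hk : 0 < k) : theta k ≠ 0 := by
  intro h
  have := theta_mul_eulerProd hk
  rw [h, zero_mul] at this
  exact eulerProd_ne_zero _ hk this.symm

theorem theta_pow_three {k : ℕ} (hk : 0 < k) : theta k ^ 3 = theta (3 * k) := by
  have hk' : 0 < 3 * k := by omega
  apply mul_right_cancel₀ (eulerProd_ne_zero 1 hk')
  rw [theta_mul_eulerProd hk', ← eulerProd_pow_three _ hk, ← mul_pow, theta_mul_eulerProd hk,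
    eulerProd_pow_three _ hk]

theorem theta_three_pow (m : ℕ) : theta (3 ^ m) = theta 1 ^ 3 ^ m := by
  induction m with
  | zero => simp
  | succ m ih => rw [pow_succ', ← theta_pow_three (by positivity), ih, ← pow_mul, mul_comm]

theorem theta_prod_range (m : ℕ) :
    theta 1 ^ 3 * ∏ i ∈ range m, theta (3 ^ (i + 1)) ^ 2 = theta 1 ^ 3 ^ (m + 1) := by
  induction m with
  | zero => simp
  | succ m ih =>
    rw [prod_range_succ, ← mul_assoc, ih, theta_three_pow, ← pow_mul, ← pow_add]
    congr 1
    ring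

/-- The character of partitions with designated summands whose parts are not divisible by `k`. -/
def pdWeight (k s m : ℕ) : ZMod 3 := if k ∣ s then 0 else m

theorem coeff_genFun_pdWeight (k n : ℕ) :
    coeff n (Nat.Partition.genFun (pdWeight k)) = (PD k n : ZMod 3) := by
  rw [Nat.Partition.coeff_genFun, PD, Nat.cast_sum]
  refine sum_congr rfl fun p _ ↦ ?_
  rw [Finsupp.prod, Multiset.toFinsupp_support]
  simp only [Multiset.toFinsupp_apply]
  split_ifs with h
  · rw [Nat.cast_prod]
    refine prod_congr rfl fun s hs ↦ ?_
    rw [pdWeight, if_neg (h s (Multiset.mem_toFinset.1 hs))]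
  · push Not at h
    obtain ⟨s, hs, hks⟩ := h
    rw [Nat.cast_zero]
    exact prod_eq_zero (Multiset.mem_toFinset.2 hs) (if_pos hks)

theorem tsum_succ_mul_pow_mul_one_sub_sq {Y : (ZMod 3)⟦X⟧} (hY : constantCoeff Y = 0)
    (hs : Summable fun j : ℕ ↦ ((j + 1 : ℕ) : (ZMod 3)⟦X⟧) * Y ^ (j + 1)) :
    (∑' j : ℕ, ((j + 1 : ℕ) : (ZMod 3)⟦X⟧) * Y ^ (j + 1)) * (1 - Y) ^ 2 = Y := by
  have hg := WithPiTopology.summable_pow_of_constantCoeff_eq_zero hY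
  have hg1 := WithPiTopology.tsum_pow_mul_one_sub_of_constantCoeff_eq_zero hY
  have hg2 : Summable fun j : ℕ ↦ Y * Y ^ (j + 1) := ((summable_nat_add_iff 1).2 hg).mul_left Y
  have hrec : ∑' j : ℕ, ((j + 1 : ℕ) : (ZMod 3)⟦X⟧) * Y ^ (j + 1) =
      Y * ∑' j : ℕ, Y ^ j + Y * ∑' j : ℕ, ((j + 1 : ℕ) : (ZMod 3)⟦X⟧) * Y ^ (j + 1) := by
    have h1 : Y * ∑' j : ℕ, Y ^ j = Y + ∑' j : ℕ, Y * Y ^ (j + 1) := by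
      rw [← hg.tsum_mul_left, (hg.mul_left Y).tsum_eq_zero_add, pow_zero, mul_one]
    rw [h1, ← hs.tsum_mul_left, add_assoc, ← hg2.tsum_add (hs.mul_left Y), hs.tsum_eq_zero_add]
    congr 1
    · simp
    · refine tsum_congr fun j ↦ ?_
      push_cast
      ring
  linear_combination (1 - Y) * hrec + Y * hg1

theorem designated_series_mul (i : ℕ) :
    (1 + ∑' j : ℕ, ((j + 1 : ℕ) : ZMod 3) • (X : (ZMod 3)⟦X⟧) ^ ((i + 1) * (j + 1))) *
      (1 - X ^ (i + 1)) ^ 2 = (1 + X ^ (i + 1)) ^ 2 := by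
  have hs := Nat.Partition.summable_genFun_term (fun _ m ↦ (m : ZMod 3)) i
  simp only [smul_eq_C_mul, map_natCast, pow_mul] at hs ⊢
  have h := tsum_succ_mul_pow_mul_one_sub_sq (by simp) hs
  have := charP_three
  have h3 : (3 : (ZMod 3)⟦X⟧) = 0 := by
    exact_mod_cast CharP.cast_eq_zero (ZMod 3)⟦X⟧ 3
  linear_combination h - X ^ (i + 1) * h3

theorem hasProd_ite_dvd_eulerProd (ε : ZMod 3) {k : ℕ} (hk : 0 < k) :
    HasProd (fun i : ℕ ↦ if k ∣ i + 1 then (1 + C ε * X ^ (i + 1) : (ZMod 3)⟦X⟧) else 1)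
      (eulerProd ε k) := by
  have hpos : ∀ i : ℕ, k * (i + 1) - 1 + 1 = k * (i + 1) := fun i ↦
    Nat.sub_add_cancel (by nlinarith)
  have hinj : Function.Injective fun i : ℕ ↦ k * (i + 1) - 1 := fun a b hab ↦ by
    have : k * (a + 1) = k * (b + 1) := by
      rw [← hpos a, ← hpos b]
      exact congrArg (· + 1) hab
    exact Nat.succ_injective (Nat.eq_of_mul_eq_mul_left hk this)
  rw [← hinj.hasProd_iff]
  · convert hasProd_eulerProd ε hk using 2
    simp [hpos]
  · intro x hx
    refine if_neg fun ⟨c, hc⟩ ↦ hx ⟨c - 1, ?_⟩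
    rcases c with _ | c
    · simp at hc
    · simp [← hc]

theorem genFun_pdWeight_mul_eulerProd {k : ℕ} (hk : 0 < k) :
    Nat.Partition.genFun (pdWeight k) * eulerProd (-1) 1 ^ 2 * eulerProd 1 k ^ 2 =
      eulerProd 1 1 ^ 2 * eulerProd (-1) k ^ 2 := by
  have hG := Nat.Partition.hasProd_genFun (pdWeight k)
  have hE : ∀ ε, HasProd (fun i : ℕ ↦ (1 + C ε * X ^ (i + 1) : (ZMod 3)⟦X⟧)) (eulerProd ε 1) := by
    intro ε
    simpa using hasProd_eulerProd ε one_pos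
  have hL := (hG.mul ((hE (-1)).pow 2)).mul ((hasProd_ite_dvd_eulerProd 1 hk).pow 2)
  have hR := ((hE 1).pow 2).mul ((hasProd_ite_dvd_eulerProd (-1) hk).pow 2)
  refine hL.unique ?_
  convert hR using 2
  · rfl
  rename_i i
  by_cases h : k ∣ i + 1
  · simp [pdWeight, h]
    ring
  · have := designated_series_mul i
    simp only [pdWeight, h, if_false, map_neg, map_one, neg_mul, one_mul, ← sub_eq_add_neg,
      one_pow, mul_one]
    exact this

theorem genFun_pdWeight_mul_theta {k : ℕ} (hk : 0 < k) :
    Nat.Partition.genFun (pdWeight k) * theta 1 ^ 2 = theta k ^ 2 := by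
  have h := genFun_pdWeight_mul_eulerProd hk
  rw [← theta_mul_eulerProd one_pos, ← theta_mul_eulerProd hk] at h
  apply mul_right_cancel₀ (mul_ne_zero (pow_ne_zero 2 (eulerProd_ne_zero 1 one_pos))
    (pow_ne_zero 2 (eulerProd_ne_zero 1 hk)))
  linear_combination h

theorem genFun_pdWeight_three_pow (m : ℕ) :
    Nat.Partition.genFun (pdWeight (3 ^ (m + 1))) =
      theta 1 * ((∏ i : Fin m, theta (3 ^ ((i : ℕ) + 1)) ^ 2) * theta (3 ^ (m + 1))) := by
  apply mul_right_cancel₀ (pow_ne_zero 2 (theta_ne_zero one_pos))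
  rw [genFun_pdWeight_mul_theta (by positivity),
    Fin.prod_univ_eq_prod_range (fun i ↦ theta (3 ^ (i + 1)) ^ 2)]
  have h := theta_prod_range m
  rw [← theta_three_pow] at h
  linear_combination (-theta (3 ^ (m + 1))) * h

/-- The weight of a tuple, split along the coordinates. -/
def tupleWeight (m : ℕ) (x : OddPos × (Fin m → OddPos × OddPos) × OddPos) : ℕ :=
  oddPosWeight 1 x.1 +
    (∑ i : Fin m, (oddPosWeight (3 ^ ((i : ℕ) + 1)) (x.2.1 i).1 +
      oddPosWeight (3 ^ ((i : ℕ) + 1)) (x.2.1 i).2) + oddPosWeight (3 ^ (m + 1)) x.2.2)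

theorem weightSeries_tupleWeight (m : ℕ) :
    weightSeries (tupleWeight m) =
      theta 1 * ((∏ i : Fin m, theta (3 ^ ((i : ℕ) + 1)) ^ 2) * theta (3 ^ (m + 1))) := by
  have hf : ∀ j, ∀ n, Finite {x : OddPos // oddPosWeight (3 ^ j) x = n} := fun j ↦
    finite_oddPos_weight (by positivity)
  obtain ⟨hfin, hpi⟩ := weightSeries_pi (m := m)
    (w := fun i (p : OddPos × OddPos) ↦
      oddPosWeight (3 ^ ((i : ℕ) + 1)) p.1 + oddPosWeight (3 ^ ((i : ℕ) + 1)) p.2)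
    fun i ↦ finite_weight_prod (hf _) (hf _)
  have h1 := weightSeries_prod hfin (hf (m + 1))
  have h2 := weightSeries_prod (finite_oddPos_weight one_pos)
    (finite_weight_prod hfin (hf (m + 1)))
  refine h2.trans ?_
  rw [h1, hpi]
  simp only [theta]
  congr 2
  refine prod_congr rfl fun i _ ↦ ?_
  rw [sq]
  exact weightSeries_prod (hf _) (hf _)

theorem tupleWeight_eq_iff (m n : ℕ) (x : OddPos × (Fin m → OddPos × OddPos) × OddPos) :
    tupleWeight m x = n ↔ (n : ℤ) = x.1.1 ^ 2 +
      (∑ i : Fin m, (3 : ℤ) ^ ((i : ℕ) + 1) * ((x.2.1 i).1.1 ^ 2 + (x.2.1 i).2.1 ^ 2)) +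
      3 ^ (m + 1) * x.2.2.1 ^ 2 := by
  simp only [tupleWeight, oddPosWeight]
  rw [← Nat.cast_inj (R := ℤ), eq_comm]
  push_cast
  simp only [sq_abs, mul_add, one_mul, add_assoc]

/-- The tuples counted in the theorem, as tuples of elements of `OddPos` of given weight. -/
def tupleEquiv (m n : ℕ) :
    {x : ℤ × (Fin m → ℤ × ℤ) × ℤ //
        (n : ℤ) = x.1 ^ 2 +
            (∑ i : Fin m, (3 : ℤ) ^ ((i : ℕ) + 1) * ((x.2.1 i).1 ^ 2 + (x.2.1 i).2 ^ 2)) +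
            3 ^ (m + 1) * x.2.2 ^ 2 ∧
        (Odd x.1 → 0 < x.1) ∧
        (∀ i : Fin m,
          (Odd (x.2.1 i).1 → 0 < (x.2.1 i).1) ∧ (Odd (x.2.1 i).2 → 0 < (x.2.1 i).2)) ∧
        (Odd x.2.2 → 0 < x.2.2)} ≃ {x // tupleWeight m x = n} where
  toFun x := ⟨(⟨x.1.1, x.2.2.1⟩, fun i ↦ (⟨(x.1.2.1 i).1, (x.2.2.2.1 i).1⟩,
    ⟨(x.1.2.1 i).2, (x.2.2.2.1 i).2⟩), ⟨x.1.2.2, x.2.2.2.2⟩), (tupleWeight_eq_iff ..).2 x.2.1⟩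
  invFun x := ⟨(x.1.1.1, fun i ↦ ((x.1.2.1 i).1.1, (x.1.2.1 i).2.1), x.1.2.2.1),
    (tupleWeight_eq_iff ..).1 x.2, x.1.1.2, fun i ↦ ⟨(x.1.2.1 i).1.2, (x.1.2.1 i).2.2⟩,
    x.1.2.2.2⟩
  left_inv _ := rfl
  right_inv _ := rfl

theorem stmt_15 (n ℓ : ℕ) (hℓ : 1 ≤ ℓ) :
    PD (3 ^ ℓ) n ≡
      Nat.card {x : ℤ × (Fin (ℓ - 1) → ℤ × ℤ) × ℤ //
        (n : ℤ) = x.1 ^ 2 +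
            (∑ i : Fin (ℓ - 1), (3 : ℤ) ^ ((i : ℕ) + 1) * ((x.2.1 i).1 ^ 2 + (x.2.1 i).2 ^ 2)) +
            3 ^ ℓ * x.2.2 ^ 2 ∧
        (Odd x.1 → 0 < x.1) ∧
        (∀ i : Fin (ℓ - 1),
          (Odd (x.2.1 i).1 → 0 < (x.2.1 i).1) ∧ (Odd (x.2.1 i).2 → 0 < (x.2.1 i).2)) ∧
        (Odd x.2.2 → 0 < x.2.2)} [MOD 3] := by
  obtain ⟨m, rfl⟩ := Nat.exists_eq_add_of_le' hℓ
  rw [← ZMod.natCast_eq_natCast_iff, ← coeff_genFun_pdWeight, genFun_pdWeight_three_pow,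
    ← weightSeries_tupleWeight, weightSeries, coeff_mk]
  exact congrArg _ (Nat.card_congr (tupleEquiv m n)).symm
end

section
/- For all integers n ≥ 0, PD_3(9n + 6) ≡ 0 (mod 3); moreover, for all integers n ≥ 0 and all ℓ ≥ 1, PD_{3^ℓ}(3n + 2) ≡ 0 (mod 3). -/
open PowerSeries Finset
open scoped PowerSeries.WithPiTopology

/-- A finite form of Gauss's identity `∏ (1 - x ^ i) / (1 + x ^ i) = ∑ (-1) ^ s x ^ (s ^ 2)`:
the partial product of length `n` plus correction terms, all divisible by `x ^ (n + 1)`,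
is a partial sum of the theta series. -/
lemma gauss_prod_add_sum_eq {R : Type*} [CommRing R] (x : R) (r : ℕ → R)
    (hr : ∀ i, (1 + x ^ (i + 1)) * r i = 1) (n : ℕ) :
    ∏ i ∈ Ico 0 n, (1 - x ^ (i + 1)) * r i +
      ∑ t ∈ range n, (-1) ^ (t + 1) * (∏ i ∈ Ico (t + 1) n, (1 - x ^ (i + 1)) * r i) *
        x ^ ((t + 1) * (n + 1)) * (2 * r t) =
    1 + 2 * ∑ t ∈ range n, (-1) ^ (t + 1) * x ^ ((t + 1) ^ 2) := by
  induction n with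
  | zero => simp
  | succ n ih =>
    have telescope : ∀ m ≤ n,
        (∏ i ∈ Ico 0 n, (1 - x ^ (i + 1)) * r i) * ((1 - x ^ (n + 1)) * r n - 1) +
          ∑ t ∈ range m, (-1) ^ (t + 1) * (∏ i ∈ Ico (t + 1) n, (1 - x ^ (i + 1)) * r i) *
            ((1 - x ^ (n + 1)) * r n * x ^ ((t + 1) * (n + 2)) - x ^ ((t + 1) * (n + 1))) *
            (2 * r t) =
        -2 * r n * ((-1) ^ m * (∏ i ∈ Ico m n, (1 - x ^ (i + 1)) * r i) *
          x ^ ((n + 1) * (m + 1))) := by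
      intro m
      induction m with
      | zero =>
        intro _
        simp only [range_zero, sum_empty, pow_zero, zero_add, mul_one, one_mul, add_zero]
        linear_combination (∏ i ∈ Ico 0 n, (1 - x ^ (i + 1)) * r i) * hr n
      | succ m ihm =>
        intro hm
        rw [sum_range_succ, ← add_assoc, ihm (by omega), prod_eq_prod_Ico_succ_bot (by omega)]
        have e1 : x ^ ((m + 1) * (n + 2)) = x ^ ((m + 1) * (n + 1)) * x ^ (m + 1) := by ring
        have e2 : x ^ ((n + 1) * (m + 1 + 1)) = x ^ ((m + 1) * (n + 1)) * x ^ (n + 1) := by ring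
        have e3 : x ^ ((n + 1) * (m + 1)) = x ^ ((m + 1) * (n + 1)) := by ring
        rw [e1, e2, e3, pow_succ (-1 : R) m]
        generalize ∏ i ∈ Ico (m + 1) n, (1 - x ^ (i + 1)) * r i = Q
        have hm' := hr m
        have hn' := hr n
        generalize x ^ ((m + 1) * (n + 1)) = w
        generalize x ^ (m + 1) = y at *
        generalize x ^ (n + 1) = z at *
        linear_combination (-1) ^ m * Q * w * 2 * (r n * z * hm' - r m * hn')
    have key := telescope n le_rfl
    have split : ∀ t ∈ range n,
        (-1) ^ (t + 1) * (∏ i ∈ Ico (t + 1) (n + 1), (1 - x ^ (i + 1)) * r i) *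
          x ^ ((t + 1) * (n + 1 + 1)) * (2 * r t) =
        (-1) ^ (t + 1) * (∏ i ∈ Ico (t + 1) n, (1 - x ^ (i + 1)) * r i) *
            ((1 - x ^ (n + 1)) * r n * x ^ ((t + 1) * (n + 2)) - x ^ ((t + 1) * (n + 1))) *
            (2 * r t) +
          (-1) ^ (t + 1) * (∏ i ∈ Ico (t + 1) n, (1 - x ^ (i + 1)) * r i) *
            x ^ ((t + 1) * (n + 1)) * (2 * r t) := by
      intro t ht
      rw [prod_Ico_succ_top (by simp at ht; omega)]
      ring
    rw [sum_range_succ, sum_range_succ, sum_congr rfl split, sum_add_distrib,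
      prod_Ico_succ_top (by omega)]
    simp only [Ico_self, prod_empty, mul_one] at key ⊢
    have e1 : x ^ ((n + 1) * (n + 1 + 1)) = x ^ ((n + 1) ^ 2) * x ^ (n + 1) := by ring
    have e2 : x ^ ((n + 1) * (n + 1)) = x ^ ((n + 1) ^ 2) := by ring
    rw [e2] at key
    rw [e1]
    linear_combination ih + key + 2 * (-1) ^ (n + 1) * x ^ ((n + 1) ^ 2) * hr n

lemma pow_succ_dvd_gauss_prod_sub {R : Type*} [CommRing R] (x : R) (r : ℕ → R)
    (hr : ∀ i, (1 + x ^ (i + 1)) * r i = 1) (n : ℕ) :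
    x ^ (n + 1) ∣ ∏ i ∈ range n, (1 - x ^ (i + 1)) * r i -
      (1 + 2 * ∑ t ∈ range n, (-1) ^ (t + 1) * x ^ ((t + 1) ^ 2)) := by
  rw [← gauss_prod_add_sum_eq x r hr n, range_eq_Ico, sub_add_cancel_left, dvd_neg]
  refine dvd_sum fun t _ ↦ dvd_mul_of_dvd_left (dvd_mul_of_dvd_right (pow_dvd_pow x ?_) _) _
  exact Nat.le_mul_of_pos_left _ t.succ_pos

/-- The factors `(1 - X ^ (i + 1)) / (1 + X ^ (i + 1))` of Gauss's product. -/
noncomputable def gaussFactor (K : Type*) [Field K] (i : ℕ) : K⟦X⟧ :=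
  (1 - X ^ (i + 1)) * (1 + X ^ (i + 1))⁻¹

section Field

variable {K : Type*} [Field K]

lemma one_add_X_pow_mul_inv (i : ℕ) : (1 + X ^ (i + 1) : K⟦X⟧) * (1 + X ^ (i + 1))⁻¹ = 1 :=
  PowerSeries.mul_inv_cancel _ (by simp)

lemma gaussFactor_mul (i : ℕ) : gaussFactor K i * (1 + X ^ (i + 1)) = 1 - X ^ (i + 1) := by
  rw [gaussFactor]
  linear_combination (1 - X ^ (i + 1) : K⟦X⟧) * one_add_X_pow_mul_inv (K := K) i

lemma one_add_X_pow_ne_zero (i : ℕ) : (1 + X ^ (i + 1) : K⟦X⟧) ≠ 0 :=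
  left_ne_zero_of_mul_eq_one (one_add_X_pow_mul_inv i)

variable [TopologicalSpace K]

lemma multipliable_gaussFactor : Multipliable (gaussFactor K) := by
  have h : gaussFactor K = fun i ↦ 1 + X ^ (i + 1) * (-2 * (1 + X ^ (i + 1))⁻¹) := by
    funext i
    rw [gaussFactor]
    linear_combination one_add_X_pow_mul_inv (K := K) i
  rw [h]
  apply WithPiTopology.multipliable_one_add_of_tendsto_order_atTop_nhds_top
  refine ENat.tendsto_nhds_top_iff_natCast_lt.mpr fun n ↦ Filter.eventually_atTop.mpr ⟨n, ?_⟩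
  intro m hm
  refine lt_of_lt_of_le ?_ (le_order_mul _ _)
  rw [order_X_pow]
  exact lt_of_lt_of_le (by exact_mod_cast Nat.lt_succ_of_le hm) le_self_add

lemma coeff_gauss_tprod [DiscreteTopology K] (m : ℕ) :
    coeff m (∏' i, gaussFactor K i) =
      coeff m (1 + 2 * ∑ t ∈ range m, (-1) ^ (t + 1) * X ^ ((t + 1) ^ 2) : K⟦X⟧) := by
  have lim := (WithPiTopology.tendsto_iff_coeff_tendsto _ _ _ _).mp
    (multipliable_gaussFactor (K := K)).hasProd.tendsto_prod_nat m
  rw [nhds_discrete, Filter.tendsto_pure] at lim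
  obtain ⟨n, hn, hmn⟩ := (lim.and (Filter.eventually_ge_atTop m)).exists
  have h := X_pow_dvd_iff.mp (pow_succ_dvd_gauss_prod_sub (X : K⟦X⟧) _ one_add_X_pow_mul_inv n) m
    (by omega)
  rw [map_sub, sub_eq_zero] at h
  rw [← hn]
  refine h.trans ?_
  obtain ⟨d, rfl⟩ := Nat.exists_eq_add_of_le hmn
  rw [sum_range_add, mul_add, ← add_assoc, map_add]
  refine add_eq_left.mpr (X_pow_dvd_iff.mp ?_ m m.lt_succ_self)
  refine dvd_mul_of_dvd_right (dvd_sum fun t _ ↦ dvd_mul_of_dvd_right (pow_dvd_pow _ ?_) _) _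
  exact le_trans (by omega : m + 1 ≤ m + t + 1) (Nat.le_self_pow two_ne_zero _)

lemma coeff_gauss_tprod_of_not_isSquare [DiscreteTopology K] {m : ℕ} (hm : ¬ IsSquare m) :
    coeff m (∏' i, gaussFactor K i) = 0 := by
  rw [coeff_gauss_tprod, map_add, coeff_one, if_neg (by rintro rfl; exact hm (IsSquare.zero)),
    zero_add, mul_sum, map_sum]
  refine sum_eq_zero fun t _ ↦ ?_
  have e : (2 * ((-1) ^ (t + 1) * X ^ ((t + 1) ^ 2)) : K⟦X⟧) =
      C (2 * (-1) ^ (t + 1)) * X ^ ((t + 1) ^ 2) := by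
    rw [map_mul, map_pow, map_neg, map_one, map_ofNat, mul_assoc]
  rw [e, coeff_C_mul, coeff_X_pow, if_neg, mul_zero]
  rintro rfl
  exact hm ⟨t + 1, sq _⟩

lemma gauss_tprod_ne_zero [DiscreteTopology K] : ∏' i, gaussFactor K i ≠ 0 := by
  intro h
  simpa [h] using coeff_gauss_tprod (K := K) 0

end Field

/-- The weights on part multiplicities whose generating function is that of `PD k`. -/
def designatedWeight (R : Type*) [Semiring R] (k i c : ℕ) : R := if k ∣ i then 0 else c

lemma coeff_genFun_designatedWeight (R : Type*) [CommSemiring R] (k n : ℕ) :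
    coeff n (Nat.Partition.genFun (designatedWeight R k)) = (PD k n : R) := by
  rw [Nat.Partition.coeff_genFun, PD, Nat.cast_sum]
  refine sum_congr rfl fun p _ ↦ ?_
  rw [Finsupp.prod, Multiset.toFinsupp_support]
  split_ifs with h
  · rw [Nat.cast_prod]
    refine prod_congr rfl fun s hs ↦ ?_
    simp [designatedWeight, h s (Multiset.mem_toFinset.mp hs)]
  · push Not at h
    obtain ⟨s, hs, hks⟩ := h
    rw [Nat.cast_zero]
    exact prod_eq_zero (Multiset.mem_toFinset.mpr hs) (by simp [designatedWeight, hks])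

lemma tsum_succ_smul_X_pow_mul {R : Type*} [CommRing R] [TopologicalSpace R] [T2Space R]
    [IsTopologicalRing R] (i : ℕ) :
    (∑' j, ((j + 1 : ℕ) : R) • (X : R⟦X⟧) ^ ((i + 1) * (j + 1))) * (1 - X ^ (i + 1)) ^ 2 =
      X ^ (i + 1) := by
  have sD := Nat.Partition.summable_genFun_term (fun _ c ↦ (c : R)) i
  have sE := Nat.Partition.summable_genFun_term (fun _ _ ↦ (1 : R)) i
  simp only [one_smul] at sE
  have hE : ∑' j, (X : R⟦X⟧) ^ ((i + 1) * (j + 1)) =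
      X ^ (i + 1) + X ^ (i + 1) * ∑' j, (X : R⟦X⟧) ^ ((i + 1) * (j + 1)) := by
    conv_lhs => rw [sE.tsum_eq_zero_add]
    rw [← sE.tsum_mul_left]
    congr 1
    · simp
    · exact tsum_congr fun j ↦ by ring
  have hD : ∑' j, ((j + 1 : ℕ) : R) • (X : R⟦X⟧) ^ ((i + 1) * (j + 1)) =
      X ^ (i + 1) + X ^ (i + 1) * (∑' j, ((j + 1 : ℕ) : R) • (X : R⟦X⟧) ^ ((i + 1) * (j + 1)) +
        ∑' j, (X : R⟦X⟧) ^ ((i + 1) * (j + 1))) := by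
    conv_lhs => rw [sD.tsum_eq_zero_add]
    rw [← sD.tsum_add sE, ← (sD.add sE).tsum_mul_left]
    congr 1
    · simp
    · refine tsum_congr fun j ↦ ?_
      simp only [smul_eq_C_mul]
      push_cast
      simp only [map_add, map_one]
      ring
  linear_combination (1 - X ^ (i + 1)) * hD + X ^ (i + 1) * hE

instance charP_powerSeries_zmod_three : CharP (ZMod 3)⟦X⟧ 3 :=
  charP_of_injective_ringHom (f := C) C_injective 3

lemma three_eq_zero_powerSeries : (3 : (ZMod 3)⟦X⟧) = 0 :=
  CharP.cast_eq_zero (ZMod 3)⟦X⟧ 3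

lemma gaussFactor_pow_three_pow (ℓ i j : ℕ) (h : j + 1 = 3 ^ ℓ * (i + 1)) :
    gaussFactor (ZMod 3) j = gaussFactor (ZMod 3) i ^ 3 ^ ℓ := by
  apply mul_right_cancel₀ (one_add_X_pow_ne_zero j)
  rw [gaussFactor_mul, h, mul_comm, pow_mul,
    show (1 + (X ^ (i + 1)) ^ 3 ^ ℓ : (ZMod 3)⟦X⟧) = (1 + X ^ (i + 1)) ^ 3 ^ ℓ by
      rw [add_pow_char_pow, one_pow], ← mul_pow, gaussFactor_mul, sub_pow_char_pow, one_pow]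

lemma genFun_mul_gauss_tprod_sq (ℓ : ℕ) :
    Nat.Partition.genFun (designatedWeight (ZMod 3) (3 ^ ℓ)) *
      (∏' i, gaussFactor (ZMod 3) i) ^ 2 = (∏' i, gaussFactor (ZMod 3) i) ^ (3 ^ ℓ * 2) := by
  have hA := (multipliable_gaussFactor (K := ZMod 3)).hasProd
  have hpow (e : ℕ) : HasProd (fun i ↦ gaussFactor (ZMod 3) i ^ e)
      ((∏' i, gaussFactor (ZMod 3) i) ^ e) :=
    hA.map (powMonoidHom e) (continuous_pow e)
  have hpos : 0 < 3 ^ ℓ := by positivity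
  have hL := (Nat.Partition.hasProd_genFun (designatedWeight (ZMod 3) (3 ^ ℓ))).mul (hpow 2)
  have hfac (i : ℕ) : (1 + ∑' j, designatedWeight (ZMod 3) (3 ^ ℓ) (i + 1) (j + 1) •
      (X : (ZMod 3)⟦X⟧) ^ ((i + 1) * (j + 1))) * gaussFactor (ZMod 3) i ^ 2 =
      if 3 ^ ℓ ∣ i + 1 then gaussFactor (ZMod 3) i ^ 2 else 1 := by
    split_ifs with h
    · simp [designatedWeight, h]
    · simp only [designatedWeight, h, if_false]
      apply mul_right_cancel₀ (pow_ne_zero 2 (one_add_X_pow_ne_zero i))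
      rw [mul_assoc, ← mul_pow, gaussFactor_mul]
      linear_combination tsum_succ_smul_X_pow_mul (R := ZMod 3) i -
        X ^ (i + 1) * three_eq_zero_powerSeries
  simp only [hfac] at hL
  refine hL.unique ?_
  have hinj : Function.Injective fun i ↦ 3 ^ ℓ * (i + 1) - 1 := by
    intro i j hij
    have hi : 0 < 3 ^ ℓ * (i + 1) := by positivity
    have hj : 0 < 3 ^ ℓ * (j + 1) := by positivity
    have : 3 ^ ℓ * (i + 1) = 3 ^ ℓ * (j + 1) := by simp only at hij; omega
    simpa using Nat.eq_of_mul_eq_mul_left hpos this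
  have hsucc (i : ℕ) : 3 ^ ℓ * (i + 1) - 1 + 1 = 3 ^ ℓ * (i + 1) :=
    Nat.sub_add_cancel (Nat.mul_pos hpos i.succ_pos)
  refine (hinj.hasProd_iff ?_).mp ?_
  · intro j hj
    refine if_neg fun ⟨c, hc⟩ ↦ hj ⟨c - 1, ?_⟩
    have : c ≠ 0 := by rintro rfl; simp at hc
    simp only [Nat.sub_add_cancel (Nat.one_le_iff_ne_zero.mpr this), ← hc, Nat.add_sub_cancel]
  · have hcomp : (fun j ↦ if 3 ^ ℓ ∣ j + 1 then gaussFactor (ZMod 3) j ^ 2 else 1) ∘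
        (fun i ↦ 3 ^ ℓ * (i + 1) - 1) = fun i ↦ gaussFactor (ZMod 3) i ^ (3 ^ ℓ * 2) := by
      funext i
      simp [hsucc, gaussFactor_pow_three_pow ℓ i _ (hsucc i), pow_mul]
    exact hcomp ▸ hpow (3 ^ ℓ * 2)

lemma pow_three_eq_expand (F : (ZMod 3)⟦X⟧) : F ^ 3 = expand 3 three_ne_zero F := by
  have h := MvPowerSeries.map_frobenius_expand (p := 3) (hp := three_ne_zero) (f := F)
  rw [ZMod.frobenius_zmod, MvPowerSeries.map_id] at h
  exact h.symm

/-- With `A` Gauss's product, the generating function of `PD (3 ^ (ℓ + 1))` modulo `3` is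
`A * (A ^ (2 * 3 ^ ℓ - 1)) ^ 3`. -/
lemma genFun_eq_gauss_tprod_mul_expand (ℓ : ℕ) :
    Nat.Partition.genFun (designatedWeight (ZMod 3) (3 ^ (ℓ + 1))) =
      (∏' i, gaussFactor (ZMod 3) i) *
        expand 3 three_ne_zero ((∏' i, gaussFactor (ZMod 3) i) ^ (2 * 3 ^ ℓ - 1)) := by
  apply mul_right_cancel₀ (pow_ne_zero 2 (gauss_tprod_ne_zero (K := ZMod 3)))
  rw [genFun_mul_gauss_tprod_sq, ← pow_three_eq_expand, ← pow_mul, ← pow_succ', ← pow_add]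
  congr 1
  have : 0 < 3 ^ ℓ := by positivity
  omega

lemma mod_three_ne_two_of_isSquare {m : ℕ} (hm : IsSquare m) : m % 3 ≠ 2 := by
  obtain ⟨s, rfl⟩ := hm
  have : s % 3 < 3 := Nat.mod_lt _ (by norm_num)
  rw [Nat.mul_mod]
  interval_cases s % 3 <;> simp

theorem stmt_16 :
    (∀ n : ℕ, PD 3 (9 * n + 6) % 3 = 0) ∧
    (∀ n ℓ : ℕ, 1 ≤ ℓ → PD (3 ^ ℓ) (3 * n + 2) % 3 = 0) := by
  constructor
  · intro n
    rw [← Nat.dvd_iff_mod_eq_zero, ← ZMod.natCast_eq_zero_iff, ← coeff_genFun_designatedWeight]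
    have h := genFun_eq_gauss_tprod_mul_expand 0
    simp only [zero_add, pow_one, pow_zero, mul_one, Nat.add_one_sub_one] at h
    rw [h, coeff_mul]
    refine sum_eq_zero fun ⟨u, v⟩ huv ↦ ?_
    rw [HasAntidiagonal.mem_antidiagonal] at huv
    simp only at huv ⊢
    by_cases hv : 3 ∣ v
    · obtain ⟨j, rfl⟩ := hv
      rw [coeff_expand_mul]
      by_cases hu : IsSquare u
      · rw [coeff_gauss_tprod_of_not_isSquare (m := j), mul_zero]
        intro hj
        refine mod_three_ne_two_of_isSquare hj ?_
        obtain ⟨s, rfl⟩ := hu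
        obtain ⟨t, rfl⟩ : 3 ∣ s := by
          have : 3 ∣ s * s := by omega
          simpa [Nat.prime_three.dvd_mul] using this
        have : 3 * t * (3 * t) = 9 * (t * t) := by ring
        omega
      · rw [coeff_gauss_tprod_of_not_isSquare hu, zero_mul]
    · rw [coeff_expand_of_not_dvd _ _ _ hv, mul_zero]
  · intro n ℓ hℓ
    obtain ⟨ℓ, rfl⟩ := Nat.exists_eq_add_of_le' hℓ
    rw [← Nat.dvd_iff_mod_eq_zero, ← ZMod.natCast_eq_zero_iff, ← coeff_genFun_designatedWeight,
      genFun_eq_gauss_tprod_mul_expand, coeff_mul]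
    refine sum_eq_zero fun ⟨u, v⟩ huv ↦ ?_
    rw [HasAntidiagonal.mem_antidiagonal] at huv
    simp only at huv ⊢
    by_cases hv : 3 ∣ v
    · rw [coeff_gauss_tprod_of_not_isSquare, zero_mul]
      intro hu
      exact mod_three_ne_two_of_isSquare hu (by omega)
    · rw [coeff_expand_of_not_dvd _ _ _ hv, mul_zero]
end

section
/- For all integers n ≥ 0 and ℓ ≥ 2, PD_{3^ℓ}(3n) ≡ e*_{n,ℓ} (mod 3), where e*_{n,ℓ} denotes the number of quadruples (k_0, k_0', k_1, k_1') of integers such that n = k_0² + k_0'² + 3^{ℓ-1}(k_1² + k_1'²) and every odd coordinate of the quadruple is positive (even coordinates may be any integer of either sign). -/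
open Finset PowerSeries PowerSeries.WithPiTopology Filter

section FiniteGauss
variable {R : Type*} [CommRing R]

/-- The finite expansion whose leading term is `∏ (1 - q ^ i)`. -/
def shanksSum (q : R) (N : ℕ) : R :=
  ∑ k ∈ range (N + 1), (-1) ^ k * (∏ i ∈ Ico k N, (1 - q ^ (i + 1))) *
    (∏ i ∈ range k, (1 + q ^ i)) * q ^ ((N + 1) * k)

theorem prod_range_one_add_pow_mul (q : R) (N : ℕ) :
    (∏ i ∈ range (N + 1), (1 + q ^ i)) = 2 * ∏ i ∈ range N, (1 + q ^ (i + 1)) := by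
  rw [prod_range_succ']
  ring

theorem sum_shanksSum_sub (q : R) {N m : ℕ} (hm : m ≤ N) :
    ∑ k ∈ range (m + 1), ((-1) ^ k * (∏ i ∈ Ico k (N + 1), (1 - q ^ (i + 1))) *
        (∏ i ∈ range k, (1 + q ^ i)) * q ^ ((N + 2) * k) -
      (1 + q ^ (N + 1)) * ((-1) ^ k * (∏ i ∈ Ico k N, (1 - q ^ (i + 1))) *
        (∏ i ∈ range k, (1 + q ^ i)) * q ^ ((N + 1) * k))) =
    (-1) ^ (m + 1) * (∏ i ∈ range (m + 1), (1 + q ^ i)) * q ^ ((N + 1) * (m + 1)) *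
      ∏ i ∈ Ico m N, (1 - q ^ (i + 1)) := by
  induction m with
  | zero =>
    rw [zero_add, sum_range_one, prod_Ico_succ_top (Nat.zero_le N)]
    simp
    ring
  | succ m ih =>
    rw [sum_range_succ, ih (by omega), prod_Ico_succ_top hm,
      prod_eq_prod_Ico_succ_bot (show m < N by omega), prod_range_succ _ (m + 1)]
    ring

theorem shanksSum_succ (q : R) (N : ℕ) :
    shanksSum q (N + 1) = (1 + q ^ (N + 1)) * shanksSum q N +
      2 * (-1) ^ (N + 1) * q ^ ((N + 1) ^ 2) * ∏ i ∈ range (N + 1), (1 + q ^ (i + 1)) := by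
  have h := sum_shanksSum_sub q (le_refl N)
  rw [sum_sub_distrib, ← mul_sum] at h
  have h2 := prod_range_one_add_pow_mul q N
  rw [shanksSum, sum_range_succ, shanksSum, prod_range_succ (fun i ↦ 1 + q ^ (i + 1)) N]
  simp only [Ico_self, prod_empty, mul_one] at h ⊢
  rw [h2] at h ⊢
  linear_combination h

theorem prod_one_add_mul_sum_sq (q : R) (N : ℕ) :
    (∏ i ∈ range N, (1 + q ^ (i + 1))) *
      (1 + 2 * ∑ j ∈ range N, (-1) ^ (j + 1) * q ^ ((j + 1) ^ 2)) = shanksSum q N := by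
  induction N with
  | zero => simp [shanksSum]
  | succ N ih =>
    rw [shanksSum_succ, ← ih, sum_range_succ, prod_range_succ]
    ring

theorem pow_dvd_prod_one_add_mul_sum_sq_sub (q : R) (N : ℕ) :
    q ^ (N + 1) ∣ (∏ i ∈ range N, (1 + q ^ (i + 1))) *
      (1 + 2 * ∑ j ∈ range N, (-1) ^ (j + 1) * q ^ ((j + 1) ^ 2)) -
      ∏ i ∈ range N, (1 - q ^ (i + 1)) := by
  rw [prod_one_add_mul_sum_sq, shanksSum, sum_range_succ']
  simp only [pow_zero, Nat.Ico_zero_eq_range, prod_range_zero, mul_zero, mul_one, one_mul,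
    add_sub_cancel_right]
  exact dvd_sum fun k _ ↦ Dvd.dvd.mul_left (pow_dvd_pow _ (by nlinarith)) _

end FiniteGauss

/-- The integers in `[-N, N]` whose odd members are positive. -/
noncomputable def signedBox (N : ℕ) : Finset ℤ := {x ∈ Icc (-N : ℤ) N | Odd x → 0 < x}

theorem mem_signedBox {N : ℕ} {x : ℤ} :
    x ∈ signedBox N ↔ x.natAbs ≤ N ∧ (Odd x → 0 < x) := by
  rw [signedBox, mem_filter, mem_Icc]
  have : -(N : ℤ) ≤ x ∧ x ≤ N ↔ x.natAbs ≤ N := by omega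
  rw [this]

theorem sum_signedBox {R : Type*} [CommRing R] [CharP R 3] (q : R) (N : ℕ) :
    ∑ x ∈ signedBox N, q ^ (x.natAbs ^ 2) =
      1 + 2 * ∑ j ∈ range N, (-1) ^ (j + 1) * q ^ ((j + 1) ^ 2) := by
  have h3 : (3 : R) = 0 := by exact_mod_cast CharP.cast_eq_zero R 3
  induction N with
  | zero =>
    have : signedBox 0 = {0} := by
      ext x
      rw [mem_signedBox, mem_singleton]
      constructor
      · omega
      · rintro rfl; simp
    simp [this]
  | succ N ih =>
    rw [sum_range_succ]
    rcases Nat.even_or_odd (N + 1) with h | h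
    · have : signedBox (N + 1) = insert (N + 1 : ℤ) (insert (-(N + 1) : ℤ) (signedBox N)) := by
        ext x
        simp only [mem_insert, mem_signedBox, ← Int.not_even_iff_odd]
        have h' : Even (N + 1 : ℤ) := by exact_mod_cast h
        grind
      rw [this, sum_insert (by simp [mem_signedBox]; omega),
        sum_insert (by simp [mem_signedBox]; omega), ih, h.neg_one_pow]
      have e1 : (N + 1 : ℤ).natAbs = N + 1 := by omega
      have e2 : (-(N + 1) : ℤ).natAbs = N + 1 := by omega
      rw [e1, e2]
      ring
    · have : signedBox (N + 1) = insert (N + 1 : ℤ) (signedBox N) := by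
        ext x
        simp only [mem_insert, mem_signedBox]
        have h' : Odd (N + 1 : ℤ) := by exact_mod_cast h
        have h'' : Odd (-(N + 1) : ℤ) := h'.neg
        grind
      rw [this, sum_insert (by simp [mem_signedBox]; omega), ih, h.neg_one_pow]
      have e1 : (N + 1 : ℤ).natAbs = N + 1 := by omega
      rw [e1]
      linear_combination q ^ ((N + 1) ^ 2) * h3

/-- The theta series `∑ x, X ^ (x ^ 2)` modulo `3`, over the integers whose odd members are
positive. -/
noncomputable def signedTheta : (ZMod 3)⟦X⟧ :=
  PowerSeries.mk fun n ↦ (#{x ∈ signedBox n | x.natAbs ^ 2 = n} : ZMod 3)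

theorem X_pow_dvd_signedTheta_sub (N : ℕ) :
    X ^ (N + 1) ∣ signedTheta - ∑ x ∈ signedBox N, (X : (ZMod 3)⟦X⟧) ^ (x.natAbs ^ 2) := by
  rw [X_pow_dvd_iff]
  intro d hd
  rw [map_sub, sub_eq_zero, signedTheta, coeff_mk, map_sum]
  simp only [coeff_X_pow, sum_boole]
  congr 2
  ext x
  simp only [mem_filter, mem_signedBox]
  constructor
  · rintro ⟨h, rfl⟩
    exact ⟨⟨by omega, h.2⟩, rfl⟩
  · rintro ⟨h, h'⟩
    exact ⟨⟨h' ▸ Nat.le_self_pow two_ne_zero _, h.2⟩, h'.symm⟩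

theorem X_pow_dvd_expand_signedTheta_sub {m : ℕ} (hm : m ≠ 0) (N : ℕ) :
    X ^ (N + 1) ∣ expand m hm signedTheta -
      ∑ x ∈ signedBox N, ((X : (ZMod 3)⟦X⟧) ^ m) ^ (x.natAbs ^ 2) := by
  have := map_dvd (expand m hm) (X_pow_dvd_signedTheta_sub N)
  simp only [map_sub, map_sum, map_pow, expand_X] at this
  refine dvd_trans ?_ this
  rw [← pow_mul]
  exact pow_dvd_pow _ (Nat.le_mul_of_pos_left _ (Nat.pos_of_ne_zero hm))

theorem signedTheta_pow_three : signedTheta ^ 3 = expand 3 three_ne_zero signedTheta := by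
  have h := MvPowerSeries.map_frobenius_expand 3 three_ne_zero
    (f := (signedTheta : MvPowerSeries Unit (ZMod 3)))
  rw [ZMod.frobenius_zmod] at h
  rw [← h]
  exact congrFun (congrArg DFunLike.coe (MvPowerSeries.map_id)) _

theorem signedTheta_ne_zero : signedTheta ≠ 0 := by
  intro h
  have h0 := PowerSeries.ext_iff.mp h 0
  have : {x ∈ signedBox 0 | x.natAbs ^ 2 = 0} = {0} := by decide
  rw [signedTheta, coeff_mk, this] at h0
  simp at h0

theorem coeff_three_mul_signedTheta (n : ℕ) :
    coeff (3 * n) signedTheta = coeff n (expand 3 three_ne_zero signedTheta) := by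
  rw [coeff_expand]
  simp only [signedTheta, coeff_mk]
  split_ifs with h
  · obtain ⟨m, rfl⟩ := h
    rw [Nat.mul_div_cancel_left _ (by norm_num)]
    congr 1
    symm
    refine card_bij (fun x _ ↦ 3 * x) ?_ (by simp) ?_
    · intro x hx
      simp only [mem_filter, mem_signedBox, Int.odd_mul, Int.natAbs_mul] at hx ⊢
      obtain ⟨hx, rfl⟩ := hx
      norm_num [mul_pow]
      refine ⟨⟨by nlinarith, hx.2⟩, by ring⟩
    · intro x hx
      simp only [mem_filter, mem_signedBox] at hx
      obtain ⟨hx, hxm⟩ := hx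
      have h3 : 3 ∣ x.natAbs := Nat.prime_three.dvd_of_dvd_pow (hxm ▸ Dvd.intro _ rfl)
      obtain ⟨y, rfl⟩ := Int.natCast_dvd.mpr h3
      have hy : y.natAbs ^ 2 = m := by
        have : (3 * y).natAbs = 3 * y.natAbs := Int.natAbs_mul 3 y
        push_cast at hxm
        rw [this] at hxm
        nlinarith
      refine ⟨y, ?_, rfl⟩
      simp only [mem_filter, mem_signedBox]
      refine ⟨⟨hy ▸ Nat.le_self_pow two_ne_zero _, fun ho ↦ ?_⟩, hy⟩
      have := hx.2 (by push_cast; exact Odd.mul (by decide) ho)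
      push_cast at this
      omega
  · rw [filter_eq_empty_iff.mpr, card_empty, Nat.cast_zero]
    intro x _ hx
    have h3 : 3 ∣ x.natAbs := Nat.prime_three.dvd_of_dvd_pow (hx ▸ Dvd.intro _ rfl)
    obtain ⟨y, hy⟩ := h3
    rw [hy] at hx
    exact h ⟨y ^ 2, by nlinarith⟩

section Products

theorem hasProd_of_pos_mul {m : ℕ} (hm : m ≠ 0) (c : ℕ → (ZMod 3)⟦X⟧) {a : (ZMod 3)⟦X⟧}
    (h : HasProd (fun i ↦ c (m * (i + 1))) a) :
    HasProd (fun i ↦ if m ∣ i + 1 then c (i + 1) else 1) a := by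
  have hinj : Function.Injective fun i ↦ m * (i + 1) - 1 := by
    intro i j hij
    have h1 : 0 < m * (i + 1) := by positivity
    have h2 : 0 < m * (j + 1) := by positivity
    have h3 : m * (i + 1) = m * (j + 1) := by simp only at hij; omega
    simpa using Nat.eq_of_mul_eq_mul_left (Nat.pos_of_ne_zero hm) h3
  rw [← hinj.hasProd_iff]
  · convert h using 1
    ext1 i
    have h1 : m * (i + 1) - 1 + 1 = m * (i + 1) :=
      Nat.sub_add_cancel (Nat.mul_pos (Nat.pos_of_ne_zero hm) i.succ_pos)
    simp [h1]
  · intro x hx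
    rw [if_neg]
    rintro ⟨j, hj⟩
    refine hx ⟨j - 1, ?_⟩
    have : j ≠ 0 := by rintro rfl; omega
    simp only
    rw [Nat.sub_add_cancel (by omega), ← hj, Nat.add_sub_cancel]

theorem multipliable_one_add_of_X_pow {m : ℕ} (hm : m ≠ 0) (u : (ZMod 3)⟦X⟧) :
    Multipliable fun i ↦ 1 + u * (X : (ZMod 3)⟦X⟧) ^ (m * (i + 1)) := by
  apply multipliable_one_add_of_tendsto_order_atTop_nhds_top
  refine ENat.tendsto_nhds_top_iff_natCast_lt.mpr fun n ↦ eventually_atTop.mpr ⟨n, fun i hi ↦ ?_⟩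
  grw [← le_order_mul, order_X_pow]
  refine lt_add_of_nonneg_of_lt (by simp) ?_
  norm_cast
  have := Nat.le_mul_of_pos_left (i + 1) (Nat.pos_of_ne_zero hm)
  omega

theorem multipliable_one_add_X_pow_mul {m : ℕ} (hm : m ≠ 0) :
    Multipliable fun i ↦ 1 + (X : (ZMod 3)⟦X⟧) ^ (m * (i + 1)) := by
  simpa using multipliable_one_add_of_X_pow hm 1

theorem multipliable_one_sub_X_pow_mul {m : ℕ} (hm : m ≠ 0) :
    Multipliable fun i ↦ 1 - (X : (ZMod 3)⟦X⟧) ^ (m * (i + 1)) := by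
  simpa [sub_eq_add_neg] using multipliable_one_add_of_X_pow hm (-1)

theorem tprod_one_add_X_pow_mul_ne_zero {m : ℕ} (hm : m ≠ 0) :
    ∏' i, (1 + (X : (ZMod 3)⟦X⟧) ^ (m * (i + 1))) ≠ 0 := by
  intro h
  have h0 := PowerSeries.ext_iff.mp h 0
  simp [coeff_zero_eq_constantCoeff, (multipliable_one_add_X_pow_mul hm).map_tprod _
    (continuous_constantCoeff (ZMod 3)), hm] at h0

/-- Gauss's identity `∑ (-1) ^ j q ^ (j ^ 2) = ∏ (1 - q ^ i) / (1 + q ^ i)` at `q = X ^ m`,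
modulo `3`. -/
theorem tprod_one_add_mul_expand_signedTheta {m : ℕ} (hm : m ≠ 0) :
    (∏' i, (1 + (X : (ZMod 3)⟦X⟧) ^ (m * (i + 1)))) * expand m hm signedTheta =
      ∏' i, (1 - (X : (ZMod 3)⟦X⟧) ^ (m * (i + 1))) := by
  have hA := (multipliable_one_add_X_pow_mul hm).hasProd.tendsto_prod_nat
  have hQ := (multipliable_one_sub_X_pow_mul hm).hasProd.tendsto_prod_nat
  have hlim := (hA.mul_const (expand m hm signedTheta)).sub hQ
  have hzero : Tendsto (fun N ↦ (∏ i ∈ range N, (1 + (X : (ZMod 3)⟦X⟧) ^ (m * (i + 1)))) *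
      expand m hm signedTheta - ∏ i ∈ range N, (1 - (X : (ZMod 3)⟦X⟧) ^ (m * (i + 1))))
      atTop (nhds 0) := by
    rw [tendsto_iff_coeff_tendsto]
    refine fun d ↦ tendsto_atTop_of_eventually_const (i₀ := d) fun N hN ↦ ?_
    rw [map_zero]
    refine X_pow_dvd_iff.mp ?_ d (Nat.lt_succ_of_le hN)
    have h1 := pow_dvd_prod_one_add_mul_sum_sq_sub ((X : (ZMod 3)⟦X⟧) ^ m) N
    have : CharP (ZMod 3)⟦X⟧ 3 := charP_of_injective_ringHom PowerSeries.C_injective 3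
    rw [← sum_signedBox] at h1
    have h1' := (pow_dvd_pow_of_dvd (dvd_pow_self (X : (ZMod 3)⟦X⟧) hm) (N + 1)).trans h1
    have h2 := (X_pow_dvd_expand_signedTheta_sub hm N).mul_left
      (∏ i ∈ range N, (1 + (X : (ZMod 3)⟦X⟧) ^ (m * (i + 1))))
    convert dvd_add h2 h1' using 1
    simp only [pow_mul]
    ring
  exact sub_eq_zero.mp (tendsto_nhds_unique hlim hzero)

end Products

section GeneratingFunction

/-- The weight of a part of size `i` and multiplicity `c` in `PD k`. -/
def PDWeight (k i c : ℕ) : ZMod 3 := if k ∣ i then 0 else c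

theorem coeff_genFun_PDWeight (k n : ℕ) :
    coeff n (Nat.Partition.genFun (PDWeight k)) = (PD k n : ZMod 3) := by
  rw [Nat.Partition.coeff_genFun, PD, Nat.cast_sum]
  refine sum_congr rfl fun p _ ↦ ?_
  rw [Finsupp.prod, Multiset.toFinsupp_support]
  simp only [Multiset.toFinsupp_apply, PDWeight]
  split_ifs with h
  · rw [Nat.cast_prod]
    exact prod_congr rfl fun s hs ↦ if_neg (h s (Multiset.mem_toFinset.mp hs))
  · push Not at h
    obtain ⟨s, hs, hk⟩ := h
    rw [Nat.cast_zero]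
    exact prod_eq_zero (Multiset.mem_toFinset.mpr hs) (if_pos hk)

theorem tsum_natCast_mul_pow_mul {s : ℕ} (hs : s ≠ 0) :
    (1 + ∑' j : ℕ, ((j + 1 : ℕ) : ZMod 3) • (X : (ZMod 3)⟦X⟧) ^ (s * (j + 1))) *
      (1 - X ^ s) ^ 2 = (1 + X ^ s) ^ 2 := by
  have h3 : (3 : (ZMod 3)⟦X⟧) = 0 := by
    have : (3 : ZMod 3) = 0 := by decide
    rw [← map_ofNat (C (R := ZMod 3)) 3, this, map_zero]
  have hT := Nat.Partition.summable_genFun_term' (fun _ c ↦ (c : ZMod 3)) hs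
  have hc : constantCoeff ((X : (ZMod 3)⟦X⟧) ^ s) = 0 := by simp [hs]
  have hG := summable_pow_of_constantCoeff_eq_zero hc
  have hG1 := tsum_pow_mul_one_sub_of_constantCoeff_eq_zero hc
  set q : (ZMod 3)⟦X⟧ := X ^ s with hq
  have e : ∀ j : ℕ, ((j + 1 : ℕ) : ZMod 3) • (X : (ZMod 3)⟦X⟧) ^ (s * (j + 1)) =
      ((j + 1 : ℕ) : (ZMod 3)⟦X⟧) * q ^ (j + 1) := by
    intro j
    rw [hq, ← pow_mul, Nat.cast_smul_eq_nsmul, nsmul_eq_mul]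
  simp only [e] at hT ⊢
  have hrec : ∑' j : ℕ, ((j + 1 : ℕ) : (ZMod 3)⟦X⟧) * q ^ (j + 1) =
      q + (q * (∑' j : ℕ, ((j + 1 : ℕ) : (ZMod 3)⟦X⟧) * q ^ (j + 1)) + q ^ 2 * ∑' j : ℕ, q ^ j) := by
    rw [← hT.tsum_mul_left, ← hG.tsum_mul_left, ← (hT.mul_left q).tsum_add (hG.mul_left _),
      hT.tsum_eq_zero_add]
    congr 1
    · simp
    · refine tsum_congr fun j ↦ ?_
      push_cast
      ring
  set T := ∑' j : ℕ, ((j + 1 : ℕ) : (ZMod 3)⟦X⟧) * q ^ (j + 1)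
  linear_combination (1 - q) * hrec + q ^ 2 * hG1 - q * h3

theorem genFun_PDWeight_mul {k : ℕ} (hk : k ≠ 0) :
    Nat.Partition.genFun (PDWeight k) * signedTheta ^ 2 = expand k hk signedTheta ^ 2 := by
  have hD := Nat.Partition.hasProd_genFun (PDWeight k)
  have hA := (multipliable_one_add_X_pow_mul one_ne_zero).hasProd
  have hQ := (multipliable_one_sub_X_pow_mul one_ne_zero).hasProd
  have hAk := hasProd_of_pos_mul hk (fun i ↦ 1 + X ^ i) (multipliable_one_add_X_pow_mul hk).hasProd
  have hQk := hasProd_of_pos_mul hk (fun i ↦ 1 - X ^ i) (multipliable_one_sub_X_pow_mul hk).hasProd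
  have gauss := tprod_one_add_mul_expand_signedTheta one_ne_zero
  have gaussk := tprod_one_add_mul_expand_signedTheta hk
  have hA0 := tprod_one_add_X_pow_mul_ne_zero one_ne_zero
  have hAk0 := tprod_one_add_X_pow_mul_ne_zero hk
  rw [expand_one_apply] at gauss
  set A := ∏' i, (1 + (X : (ZMod 3)⟦X⟧) ^ (1 * (i + 1)))
  set Q := ∏' i, (1 - (X : (ZMod 3)⟦X⟧) ^ (1 * (i + 1)))
  set Ak := ∏' i, (1 + (X : (ZMod 3)⟦X⟧) ^ (k * (i + 1)))
  set Qk := ∏' i, (1 - (X : (ZMod 3)⟦X⟧) ^ (k * (i + 1)))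
  have key : Nat.Partition.genFun (PDWeight k) * (Q * Q) * (Ak * Ak) = A * A * (Qk * Qk) := by
    have h1 := (hD.mul (hQ.mul hQ)).mul (hAk.mul hAk)
    have h2 := (hA.mul hA).mul (hQk.mul hQk)
    refine h1.unique ?_
    refine (congrArg (HasProd · (A * A * (Qk * Qk))) (funext fun i ↦ ?_)).mpr h2
    rw [one_mul]
    by_cases hi : k ∣ i + 1
    · simp only [hi, PDWeight, if_true, zero_smul, tsum_zero]
      ring
    · simp only [hi, PDWeight, if_false, mul_one]
      rw [← sq, ← sq, tsum_natCast_mul_pow_mul i.succ_ne_zero]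
  rw [← gauss, ← gaussk] at key
  refine mul_right_cancel₀ (mul_ne_zero (mul_ne_zero hA0 hA0) (mul_ne_zero hAk0 hAk0)) ?_
  linear_combination key

end GeneratingFunction

section Dissection

/-- The series `∑ a (m * n) X ^ n` extracted from `∑ a n X ^ n`. -/
noncomputable def dissect {R : Type*} [CommRing R] (m : ℕ) (f : R⟦X⟧) : R⟦X⟧ :=
  PowerSeries.mk fun n ↦ coeff (m * n) f

theorem dissect_mul_expand {R : Type*} [CommRing R] {m : ℕ} (hm : m ≠ 0) (f g : R⟦X⟧) :
    dissect m (f * expand m hm g) = dissect m f * g := by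
  ext n
  simp only [dissect, coeff_mk, coeff_mul]
  symm
  refine sum_of_injOn (fun x ↦ (m * x.1, m * x.2)) ?_ ?_ ?_ ?_
  · rintro ⟨a, b⟩ _ ⟨c, d⟩ _ h
    simpa [hm] using h
  · rintro ⟨a, b⟩ h
    simp only [mem_coe, HasAntidiagonal.mem_antidiagonal] at h ⊢
    rw [← mul_add, h]
  · rintro ⟨a, b⟩ h h'
    rw [coeff_expand, if_neg, mul_zero]
    rintro ⟨c, rfl⟩
    rw [HasAntidiagonal.mem_antidiagonal] at h
    simp only at h
    obtain ⟨d, rfl⟩ : m ∣ a := (Nat.dvd_add_left (Dvd.intro _ rfl)).mp (h ▸ Dvd.intro _ rfl)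
    refine h' ⟨(d, c), ?_, rfl⟩
    rw [mem_coe, HasAntidiagonal.mem_antidiagonal]
    exact Nat.eq_of_mul_eq_mul_left (Nat.pos_of_ne_zero hm) (by rw [mul_add, h])
  · rintro ⟨a, b⟩ _
    simp only [coeff_expand_mul]

theorem dissect_genFun_PDWeight {ℓ : ℕ} (hℓ : 1 ≤ ℓ) :
    dissect 3 (Nat.Partition.genFun (PDWeight (3 ^ ℓ))) =
      signedTheta ^ 2 * expand (3 ^ (ℓ - 1)) (by positivity) signedTheta ^ 2 := by
  obtain ⟨r, rfl⟩ := Nat.exists_eq_add_of_le' hℓ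
  simp only [Nat.add_sub_cancel]
  have h := genFun_PDWeight_mul (k := 3 ^ (r + 1)) (by positivity)
  have he : expand (3 ^ (r + 1)) (by positivity) signedTheta =
      expand 3 three_ne_zero (expand (3 ^ r) (by positivity) signedTheta) := by
    rw [← expand_mul]
    congr 2
    ring
  have h' : Nat.Partition.genFun (PDWeight (3 ^ (r + 1))) * expand 3 three_ne_zero signedTheta =
      signedTheta * expand 3 three_ne_zero (expand (3 ^ r) (by positivity) signedTheta ^ 2) := by
    rw [← signedTheta_pow_three, map_pow, ← he]
    linear_combination signedTheta * h
  have h'' := congrArg (dissect 3) h'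
  have ht : dissect 3 signedTheta = signedTheta ^ 3 := by
    rw [signedTheta_pow_three]
    ext n
    rw [dissect, coeff_mk, coeff_three_mul_signedTheta]
  rw [dissect_mul_expand, dissect_mul_expand, ht] at h''
  refine mul_right_cancel₀ signedTheta_ne_zero ?_
  linear_combination h''

end Dissection

theorem coeff_signedTheta_sq_mul {m : ℕ} (hm : m ≠ 0) (n : ℕ) :
    coeff n (signedTheta ^ 2 * expand m hm signedTheta ^ 2) =
      (#{x ∈ signedBox n ×ˢ signedBox n ×ˢ signedBox n ×ˢ signedBox n |
        n = x.1.natAbs ^ 2 + x.2.1.natAbs ^ 2 + m * (x.2.2.1.natAbs ^ 2 + x.2.2.2.natAbs ^ 2)} :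
        ZMod 3) := by
  have h1 := Ideal.Quotient.eq.mpr (Ideal.mem_span_singleton.mpr (X_pow_dvd_signedTheta_sub n))
  have h2 := Ideal.Quotient.eq.mpr
    (Ideal.mem_span_singleton.mpr (X_pow_dvd_expand_signedTheta_sub hm n))
  set S := ∑ x ∈ signedBox n, (X : (ZMod 3)⟦X⟧) ^ (x.natAbs ^ 2) with hS
  set Sm := ∑ x ∈ signedBox n, ((X : (ZMod 3)⟦X⟧) ^ m) ^ (x.natAbs ^ 2) with hSm
  have h3 : X ^ (n + 1) ∣ signedTheta ^ 2 * expand m hm signedTheta ^ 2 - S ^ 2 * Sm ^ 2 := by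
    rw [← Ideal.mem_span_singleton, ← Ideal.Quotient.eq]
    simp only [map_mul, map_pow, h1, h2]
  have h4 := X_pow_dvd_iff.mp h3 n n.lt_succ_self
  rw [map_sub, sub_eq_zero] at h4
  have h5 : S ^ 2 * Sm ^ 2 =
      ∑ x ∈ signedBox n ×ˢ signedBox n ×ˢ signedBox n ×ˢ signedBox n, (X : (ZMod 3)⟦X⟧) ^
        (x.1.natAbs ^ 2 + x.2.1.natAbs ^ 2 +
          m * (x.2.2.1.natAbs ^ 2 + x.2.2.2.natAbs ^ 2)) := by
    have : S ^ 2 * Sm ^ 2 = Sm * (Sm * (S * S)) := by ring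
    rw [this, hS, hSm]
    simp only [sum_product, mul_sum, sum_mul]
    refine sum_congr rfl fun _ _ ↦ sum_congr rfl fun _ _ ↦ sum_congr rfl fun _ _ ↦
      sum_congr rfl fun _ _ ↦ ?_
    ring
  rw [h4, h5, map_sum]
  simp only [coeff_X_pow, sum_boole]

theorem stmt_18 (n ℓ : ℕ) (hℓ : 2 ≤ ℓ) :
    PD (3 ^ ℓ) (3 * n) ≡
      Nat.card {x : ℤ × ℤ × ℤ × ℤ //
        (n : ℤ) = x.1 ^ 2 + x.2.1 ^ 2 + 3 ^ (ℓ - 1) * (x.2.2.1 ^ 2 + x.2.2.2 ^ 2) ∧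
        (Odd x.1 → 0 < x.1) ∧ (Odd x.2.1 → 0 < x.2.1) ∧
        (Odd x.2.2.1 → 0 < x.2.2.1) ∧ (Odd x.2.2.2 → 0 < x.2.2.2)} [MOD 3] := by
  rw [← ZMod.natCast_eq_natCast_iff, ← coeff_genFun_PDWeight]
  have h := PowerSeries.ext_iff.mp (dissect_genFun_PDWeight (show 1 ≤ ℓ by omega)) n
  rw [dissect, coeff_mk, coeff_signedTheta_sq_mul] at h
  rw [h]
  congr 1
  rw [← Nat.subtype_card]
  rintro ⟨a, b, c, d⟩
  simp only [mem_filter, mem_product, mem_signedBox]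
  have hcast : (n = a.natAbs ^ 2 + b.natAbs ^ 2 + 3 ^ (ℓ - 1) * (c.natAbs ^ 2 + d.natAbs ^ 2)) ↔
      (n : ℤ) = a ^ 2 + b ^ 2 + 3 ^ (ℓ - 1) * (c ^ 2 + d ^ 2) := by
    zify
    simp only [sq_abs]
  rw [← hcast]
  constructor
  · rintro ⟨⟨ha, hb, hc, hd⟩, hn⟩
    exact ⟨hn, ha.2, hb.2, hc.2, hd.2⟩
  · rintro ⟨hn, ha, hb, hc, hd⟩
    have hpow : c.natAbs ^ 2 + d.natAbs ^ 2 ≤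
        3 ^ (ℓ - 1) * (c.natAbs ^ 2 + d.natAbs ^ 2) := Nat.le_mul_of_pos_left _ (by positivity)
    have ha' := Nat.le_self_pow two_ne_zero a.natAbs
    have hb' := Nat.le_self_pow two_ne_zero b.natAbs
    have hc' := Nat.le_self_pow two_ne_zero c.natAbs
    have hd' := Nat.le_self_pow two_ne_zero d.natAbs
    exact ⟨⟨⟨by omega, ha⟩, ⟨by omega, hb⟩, ⟨by omega, hc⟩, ⟨by omega, hd⟩⟩, hn⟩
end
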